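/- Let A, B ∈ ℂ^{n₁×n₁×n₃} with A ⋆ B = B ⋆ A, let k = max{ind(A), ind(B)}, and let A^{GD}, B^{GD} be GD inverses of A and B satisfying the GD equations with exponent k. If B ⋆ B^{GD} ⋆ A^{GD} = A^{GD} and A^{GD} ⋆ A ⋆ B ⋆ B* = B ⋆ B* ⋆ A^{GD} ⋆ A, then B^{GD} ⋆ A^{GD} is a GD inverse of A ⋆ B with exponent k and the corresponding GD-Star inverse satisfies (A⋆B)^{GD,*} = B^{GD,*} ⋆ A^{GD,*}, i.e., (B^{GD}⋆A^{GD}) ⋆ (A⋆B) ⋆ (A⋆B)* = (B^{GD}⋆B⋆B*) ⋆ (A^{GD}⋆A⋆A*). -/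

import Mathlib

open Matrix BigOperators

/-- A third-order complex tensor in `ℂ^{n₁ × n₂ × n₃}`, given by its frontal slices. -/
abbrev Tensor3 (n₁ n₂ n₃ : ℕ) := Fin n₃ → Matrix (Fin n₁) (Fin n₂) ℂ

/-- Mode-3 product of a tensor with an `n₃ × n₃` matrix: the slices of the result are the
indicated linear combinations of the slices of `A`. -/
noncomputable def mode3 {n₁ n₂ n₃ : ℕ} (M : Matrix (Fin n₃) (Fin n₃) ℂ) (A : Tensor3 n₁ n₂ n₃) :
    Tensor3 n₁ n₂ n₃ :=
  fun i => ∑ j, M i j • A j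

/-- The M-product `A ⋆_M B`: slice-wise matrix product in the transformed (hat) domain,
transformed back by `M⁻¹`. -/
noncomputable def mprod {n₁ n₂ l n₃ : ℕ} (M : Matrix (Fin n₃) (Fin n₃) ℂ)
    (A : Tensor3 n₁ n₂ n₃) (B : Tensor3 n₂ l n₃) : Tensor3 n₁ l n₃ :=
  mode3 M⁻¹ (fun i => mode3 M A i * mode3 M B i)

/-- The identity tensor: every slice of its mode-3 transform is the identity matrix. -/
noncomputable def idT (n₁ : ℕ) {n₃ : ℕ} (M : Matrix (Fin n₃) (Fin n₃) ℂ) : Tensor3 n₁ n₁ n₃ :=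
  mode3 M⁻¹ (fun _ => (1 : Matrix (Fin n₁) (Fin n₁) ℂ))

/-- Powers of a square tensor with respect to the M-product. -/
noncomputable def mpow {n₁ n₃ : ℕ} (M : Matrix (Fin n₃) (Fin n₃) ℂ) (A : Tensor3 n₁ n₁ n₃) :
    ℕ → Tensor3 n₁ n₁ n₃
  | 0 => idT n₁ M
  | k + 1 => mprod M (mpow M A k) A

/-- Conjugate transpose with respect to the M-product: slice-wise conjugate transpose in the
transformed domain. -/
noncomputable def ctrans {n₁ n₂ n₃ : ℕ} (M : Matrix (Fin n₃) (Fin n₃) ℂ) (A : Tensor3 n₁ n₂ n₃) :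
    Tensor3 n₂ n₁ n₃ :=
  mode3 M⁻¹ (fun i => (mode3 M A i)ᴴ)

/-- Index of a square complex matrix: the least `k ≥ 0` with `rank(B^k) = rank(B^{k+1})`. -/
noncomputable def matIndex {n : ℕ} (B : Matrix (Fin n) (Fin n) ℂ) : ℕ :=
  sInf {k : ℕ | (B ^ k).rank = (B ^ (k + 1)).rank}

/-- Index of a tensor: the maximum of the indices of the slices of its mode-3 transform. -/
noncomputable def tIndex {n₁ n₃ : ℕ} (M : Matrix (Fin n₃) (Fin n₃) ℂ)
    (A : Tensor3 n₁ n₁ n₃) : ℕ :=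
  Finset.univ.sup fun i => matIndex (mode3 M A i)

/-- `X` is a GD inverse of `A` with exponent `k`:
`A ⋆ X ⋆ A = A`, `X ⋆ A^{k+1} = A^k`, `A^{k+1} ⋆ X = A^k`. -/
def IsGD {n₁ n₃ : ℕ} (M : Matrix (Fin n₃) (Fin n₃) ℂ) (A X : Tensor3 n₁ n₁ n₃)
    (k : ℕ) : Prop :=
  mprod M (mprod M A X) A = A ∧
  mprod M X (mpow M A (k + 1)) = mpow M A k ∧
  mprod M (mpow M A (k + 1)) X = mpow M A k

/-- `X` is the Drazin inverse of `A` with exponent `k`. -/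
def IsDrazin {n₁ n₃ : ℕ} (M : Matrix (Fin n₃) (Fin n₃) ℂ) (A X : Tensor3 n₁ n₁ n₃)
    (k : ℕ) : Prop :=
  mprod M X (mpow M A (k + 1)) = mpow M A k ∧
  mprod M (mprod M X A) X = X ∧
  mprod M X A = mprod M A X

/-- `X` is the Moore–Penrose inverse of `A`. -/
def IsMP {n₁ n₃ : ℕ} (M : Matrix (Fin n₃) (Fin n₃) ℂ) (A X : Tensor3 n₁ n₁ n₃) : Prop :=
  mprod M (mprod M A X) A = A ∧
  mprod M (mprod M X A) X = X ∧
  ctrans M (mprod M A X) = mprod M A X ∧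
  ctrans M (mprod M X A) = mprod M X A

theorem mode3_mode3 {n₁ n₂ n₃ : ℕ} (M N : Matrix (Fin n₃) (Fin n₃) ℂ) (A : Tensor3 n₁ n₂ n₃) :
    mode3 M (mode3 N A) = mode3 (M * N) A := by
  funext i
  simp only [mode3, Matrix.mul_apply, Finset.smul_sum, Finset.sum_smul, smul_smul]
  exact Finset.sum_comm

theorem mode3_one {n₁ n₂ n₃ : ℕ} (A : Tensor3 n₁ n₂ n₃) : mode3 1 A = A := by
  funext i
  simp [mode3, Matrix.one_apply, ite_smul]

section Transform

variable {n₁ n₂ n₃ : ℕ} {M : Matrix (Fin n₃) (Fin n₃) ℂ}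

theorem mode3_mode3_inv (hM : IsUnit M) (A : Tensor3 n₁ n₂ n₃) :
    mode3 M (mode3 M⁻¹ A) = A := by
  rw [mode3_mode3, Matrix.mul_nonsing_inv M ((Matrix.isUnit_iff_isUnit_det M).1 hM), mode3_one]

theorem mode3_injective (hM : IsUnit M) :
    Function.Injective (mode3 M : Tensor3 n₁ n₂ n₃ → Tensor3 n₁ n₂ n₃) :=
  Function.LeftInverse.injective (g := mode3 M⁻¹) fun A => by
    rw [mode3_mode3, Matrix.nonsing_inv_mul M ((Matrix.isUnit_iff_isUnit_det M).1 hM), mode3_one]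

theorem mode3_mprod (hM : IsUnit M) (A B : Tensor3 n₁ n₁ n₃) :
    mode3 M (mprod M A B) = mode3 M A * mode3 M B :=
  mode3_mode3_inv hM _

theorem mode3_ctrans (hM : IsUnit M) (A : Tensor3 n₁ n₁ n₃) :
    mode3 M (ctrans M A) = star (mode3 M A) :=
  mode3_mode3_inv hM _

theorem mode3_mpow (hM : IsUnit M) (A : Tensor3 n₁ n₁ n₃) (k : ℕ) :
    mode3 M (mpow M A k) = mode3 M A ^ k := by
  induction k with
  | zero => exact mode3_mode3_inv hM _
  | succ k ih => rw [mpow, mode3_mprod hM, ih, pow_succ]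

theorem isGD_iff (hM : IsUnit M) (A X : Tensor3 n₁ n₁ n₃) (k : ℕ) :
    IsGD M A X k ↔ mode3 M A * mode3 M X * mode3 M A = mode3 M A ∧
      mode3 M X * mode3 M A ^ (k + 1) = mode3 M A ^ k ∧
      mode3 M A ^ (k + 1) * mode3 M X = mode3 M A ^ k := by
  simp only [IsGD, ← mode3_mprod hM, ← mode3_mpow hM, (mode3_injective hM).eq_iff]

end Transform

section Monoid

variable {R : Type*} [Monoid R] {a b x y : R} {k : ℕ}

theorem Commute.gd_reverse_order (hab : Commute a b)
    (ha : a * x * a = a ∧ x * a ^ (k + 1) = a ^ k ∧ a ^ (k + 1) * x = a ^ k)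
    (hb : y * b ^ (k + 1) = b ^ k ∧ b ^ (k + 1) * y = b ^ k) (h : b * y * x = x) :
    a * b * (y * x) * (a * b) = a * b ∧
      y * x * (a * b) ^ (k + 1) = (a * b) ^ k ∧ (a * b) ^ (k + 1) * (y * x) = (a * b) ^ k := by
  obtain ⟨ha₁, ha₂, ha₃⟩ := ha
  obtain ⟨hb₁, hb₂⟩ := hb
  refine ⟨?_, ?_, ?_⟩
  · calc a * b * (y * x) * (a * b) = a * (b * y * x) * a * b := by simp only [mul_assoc]
      _ = a * b := by rw [h, ha₁]
  · calc y * x * (a * b) ^ (k + 1) = y * (x * a ^ (k + 1)) * b ^ (k + 1) := by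
          simp only [hab.mul_pow, mul_assoc]
      _ = y * b ^ (k + 1) * a ^ k := by
          rw [ha₂, mul_assoc, (hab.pow_pow k (k + 1)).eq, ← mul_assoc]
      _ = (a * b) ^ k := by rw [hb₁, hab.mul_pow, (hab.pow_pow k k).eq]
  · calc (a * b) ^ (k + 1) * (y * x) = a ^ (k + 1) * (b ^ (k + 1) * y) * x := by
          simp only [hab.mul_pow, mul_assoc]
      _ = b ^ k * (a ^ (k + 1) * x) := by rw [hb₂, (hab.pow_pow (k + 1) k).eq, mul_assoc]
      _ = (a * b) ^ k := by rw [ha₃, hab.mul_pow, (hab.pow_pow k k).eq]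

end Monoid

/-- reverse order law for the GD-Star inverse. -/
theorem gdstar_reverse_order_law {n₁ n₃ : ℕ} (hn₁ : 0 < n₁) (hn₃ : 0 < n₃)
    (M : Matrix (Fin n₃) (Fin n₃) ℂ) (hM : IsUnit M)
    (A B AGD BGD : Tensor3 n₁ n₁ n₃) (k : ℕ)
    (hcomm : mprod M A B = mprod M B A)
    (hk : k = max (tIndex M A) (tIndex M B))
    (hAGD : IsGD M A AGD k) (hBGD : IsGD M B BGD k)
    (h1 : mprod M (mprod M B BGD) AGD = AGD)
    (h2 : mprod M (mprod M (mprod M AGD A) B) (ctrans M B) =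
      mprod M (mprod M (mprod M B (ctrans M B)) AGD) A) :
    IsGD M (mprod M A B) (mprod M BGD AGD) k ∧
    mprod M (mprod M (mprod M BGD AGD) (mprod M A B)) (ctrans M (mprod M A B)) =
      mprod M (mprod M (mprod M BGD B) (ctrans M B)) (mprod M (mprod M AGD A) (ctrans M A)) := by
  rw [isGD_iff hM] at hAGD hBGD ⊢
  rw [← (mode3_injective hM).eq_iff] at hcomm h1 h2
  simp only [mode3_mprod hM, mode3_ctrans hM] at hcomm h1 h2 ⊢
  refine ⟨Commute.gd_reverse_order hcomm hAGD hBGD.2 h1, mode3_injective hM ?_⟩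
  simp only [mode3_mprod hM, mode3_ctrans hM]
  generalize mode3 M A = a, mode3 M B = b, mode3 M AGD = x, mode3 M BGD = y at *
  calc y * x * (a * b) * star (a * b) = y * (x * a * b * star b) * star a := by
        simp only [star_mul, mul_assoc]
    _ = y * b * star b * (x * a * star a) := by rw [h2]; simp only [mul_assoc]
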